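/- (Derivative of the range projection; consequence of Theorems 9 and 10.) Let V be a real n×p matrix with VᵀV = I_p, and define, for W in a neighborhood of V where WᵀW is invertible, the orthogonal projection P(W) := W(WᵀW)⁻¹Wᵀ onto the column space of W. Then P is Fréchet differentiable at V with derivative Δ ↦ (I_n − VVᵀ)ΔVᵀ + VΔᵀ(I_n − VVᵀ). -/

import Mathlib

open Matrix

attribute [local instance] Matrix.normedAddCommGroup Matrix.normedSpace

/-- The derivative of the range-projection map `W ↦ W (Wᵀ W)⁻¹ Wᵀ` at an orthonormal `V`,
as a continuous linear map: `Δ ↦ (I - V Vᵀ) Δ Vᵀ + V Δᵀ (I - V Vᵀ)`. -/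
noncomputable def projDeriv {n p : ℕ} (V : Matrix (Fin n) (Fin p) ℝ) :
    Matrix (Fin n) (Fin p) ℝ →L[ℝ] Matrix (Fin n) (Fin n) ℝ :=
  LinearMap.toContinuousLinearMap
    { toFun := fun Δ => (1 - V * Vᵀ) * Δ * Vᵀ + V * Δᵀ * (1 - V * Vᵀ)
      map_add' := by
        intro x y
        simp [Matrix.transpose_add, Matrix.add_mul, Matrix.mul_add]
        abel
      map_smul' := by
        intro c x
        simp [Matrix.transpose_smul, Matrix.smul_mul, Matrix.mul_smul] }

/-- Product rule for products of rectangular matrices. -/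
theorem HasFDerivAt.matrix_mul {E : Type*} [NormedAddCommGroup E] [NormedSpace ℝ E]
    {l m n : Type*} [Fintype l] [Fintype m] [Fintype n]
    {f : E → Matrix l m ℝ} {g : E → Matrix m n ℝ}
    {f' : E →L[ℝ] Matrix l m ℝ} {g' : E →L[ℝ] Matrix m n ℝ} {x : E}
    (hf : HasFDerivAt f f' x) (hg : HasFDerivAt g g' x) :
    HasFDerivAt (fun y => f y * g y)
      ((mulLinearMap ℝ (f x)).toContinuousLinearMap ∘L g' +
        ((mulLinearMap ℝ).flip (g x)).toContinuousLinearMap ∘L f') x :=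
  (mulLinearMap ℝ : Matrix l m ℝ →ₗ[ℝ] Matrix m n ℝ →ₗ[ℝ] Matrix l n ℝ)
    |>.toContinuousBilinearMap.hasFDerivAt_of_bilinear hf hg

/-- Transposition commutes with the Fréchet derivative. -/
theorem HasFDerivAt.matrix_transpose {E : Type*} [NormedAddCommGroup E] [NormedSpace ℝ E]
    {m n : Type*} [Fintype m] [Fintype n]
    {f : E → Matrix m n ℝ} {f' : E →L[ℝ] Matrix m n ℝ} {x : E} (hf : HasFDerivAt f f' x) :
    HasFDerivAt (fun y => (f y)ᵀ)
      ((transposeLinearEquiv m n ℝ ℝ).toLinearMap.toContinuousLinearMap ∘L f') x :=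
  (transposeLinearEquiv m n ℝ ℝ).toLinearMap.toContinuousLinearMap.hasFDerivAt.comp x hf

/-- In a finite-dimensional normed algebra, inversion has derivative `Δ ↦ -a⁻¹ Δ a⁻¹` at every
invertible `a`. -/
theorem exists_hasFDerivAt_ringInverse_of_finiteDimensional {R : Type*} [NormedRing R]
    [NormedAlgebra ℝ R] [FiniteDimensional ℝ R] {a : R} (ha : IsUnit a) :
    ∃ f' : R →L[ℝ] R, HasFDerivAt Ring.inverse f' a ∧
      ∀ Δ, f' Δ = -(Ring.inverse a * Δ * Ring.inverse a) := by
  have : CompleteSpace R := FiniteDimensional.complete ℝ R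
  obtain ⟨u, rfl⟩ := ha
  exact ⟨_, hasFDerivAt_ringInverse u, fun Δ => by simp⟩

/-- The derivative of `W ↦ (f W)⁻¹`, where `f` is matrix-valued. -/
theorem HasFDerivAt.matrix_inv {E : Type*} [NormedAddCommGroup E] [NormedSpace ℝ E]
    {n : Type*} [Fintype n] [DecidableEq n]
    {f : E → Matrix n n ℝ} {f' : E →L[ℝ] Matrix n n ℝ} {x : E}
    (hf : HasFDerivAt f f' x) (hx : IsUnit (f x)) :
    HasFDerivAt (fun y => (f y)⁻¹)
      (-(LinearMap.mulLeftRight ℝ ((f x)⁻¹, (f x)⁻¹)).toContinuousLinearMap ∘L f') x := by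
  -- The algebra norm differs from the entrywise one, but induces the same topology.
  obtain ⟨g', hg', happly⟩ : ∃ g' : Matrix n n ℝ →L[ℝ] Matrix n n ℝ,
      HasFDerivAt Ring.inverse g' (f x) ∧
        ∀ Δ, g' Δ = -(Ring.inverse (f x) * Δ * Ring.inverse (f x)) :=
    let _ : NormedRing (Matrix n n ℝ) := Matrix.linftyOpNormedRing
    let _ : NormedAlgebra ℝ (Matrix n n ℝ) := Matrix.linftyOpNormedAlgebra
    exists_hasFDerivAt_ringInverse_of_finiteDimensional hx
  simp only [nonsing_inv_eq_ringInverse]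
  refine (hg'.comp x hf).congr_fderiv ?_
  ext1 Δ
  exact happly (f' Δ)

/-- The orthogonal projection onto the column space, `P W = W (Wᵀ W)⁻¹ Wᵀ`, is Fréchet
differentiable at any `V` with orthonormal columns (`Vᵀ V = I`), with derivative
`Δ ↦ (I - V Vᵀ) Δ Vᵀ + V Δᵀ (I - V Vᵀ)`. -/
theorem hasFDerivAt_rangeProj {n p : ℕ} (V : Matrix (Fin n) (Fin p) ℝ)
    (horth : Vᵀ * V = 1) :
    HasFDerivAt (fun W : Matrix (Fin n) (Fin p) ℝ => W * (Wᵀ * W)⁻¹ * Wᵀ)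
      (projDeriv V) V := by
  have hid := hasFDerivAt_id (𝕜 := ℝ) V
  have hgram := hid.matrix_transpose.matrix_mul hid
  have hinv := hgram.matrix_inv (by simp [horth])
  have hproj := (hid.matrix_mul hinv).matrix_mul hid.matrix_transpose
  refine hproj.congr_fderiv ?_
  ext1 Δ
  change V * (Vᵀ * V)⁻¹ * Δᵀ +
      (V * -((Vᵀ * V)⁻¹ * (Vᵀ * Δ + Δᵀ * V) * (Vᵀ * V)⁻¹) + Δ * (Vᵀ * V)⁻¹) * Vᵀ =
    (1 - V * Vᵀ) * Δ * Vᵀ + V * Δᵀ * (1 - V * Vᵀ)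
  rw [horth]
  simp only [inv_one, Matrix.one_mul, Matrix.mul_one, Matrix.mul_add, Matrix.add_mul,
    Matrix.mul_sub, Matrix.sub_mul, Matrix.mul_neg, Matrix.neg_mul, Matrix.mul_assoc]
  abel
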